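/- arXiv:1703.01070 — 6 statements merged into one kernel-verified Lean document; each statement's English description precedes it below -/
import Mathlib

section
/- Let a ≠ 0 and λ₁, λ₂ be real constants and define z : ℝ² → ℝ by z(x,y) = tanh(a·x + λ₁)·(y + λ₂). Then for all (x,y) ∈ ℝ², one has 1 − (∂z/∂y)² = sech²(a·x + λ₁) ≠ 0 and (∂²z/∂x²)(∂²z/∂y²) − (∂²z/∂x∂y)² = −a²·(1 − (∂z/∂y)²)². In particular, the factorable surface of first kind z = tanh(a x + λ₁)(y + λ₂) has constant Gaussian curvature K = −a² in the pseudo-Galilean space. -/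
theorem Real.hasDerivAt_tanh_eq_one_div_cosh_sq (u : ℝ) :
    HasDerivAt Real.tanh ((1 / Real.cosh u) ^ 2) u := by
  have hc : Real.cosh u ≠ 0 := (Real.cosh_pos u).ne'
  rw [funext Real.tanh_eq_sinh_div_cosh]
  refine ((Real.hasDerivAt_sinh u).div (Real.hasDerivAt_cosh u) hc).congr_deriv ?_
  field_simp
  linarith [Real.cosh_sq u]

theorem Real.one_sub_tanh_sq_eq_one_div_cosh_sq (u : ℝ) :
    1 - Real.tanh u ^ 2 = (1 / Real.cosh u) ^ 2 := by
  have hc : Real.cosh u ≠ 0 := (Real.cosh_pos u).ne'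
  rw [Real.tanh_eq_sinh_div_cosh]
  field_simp
  linarith [Real.cosh_sq u]

theorem deriv_const_mul_add_const (c d y : ℝ) :
    deriv (fun t => c * (t + d)) y = c := by simp


/-- The factorable surface of first kind `z(x,y) = tanh(a x + lam₁)(y + lam₂)` satisfies
`1 - z_y² = sech²(a x + lam₁) ≠ 0` and `z_xx z_yy - z_xy² = -a² (1 - z_y²)²`,
hence has constant Gaussian curvature `K = -a²`. -/
theorem tanh_factorable_surface_constant_gauss_curvature
    (a lam₁ lam₂ : ℝ) (ha : a ≠ 0) :
    ∀ x y : ℝ,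
      (1 - (deriv (fun t => Real.tanh (a * x + lam₁) * (t + lam₂)) y) ^ 2
          = (1 / Real.cosh (a * x + lam₁)) ^ 2) ∧
      ((1 / Real.cosh (a * x + lam₁)) ^ 2 ≠ 0) ∧
      (deriv (deriv (fun s => Real.tanh (a * s + lam₁) * (y + lam₂))) x *
          deriv (deriv (fun t => Real.tanh (a * x + lam₁) * (t + lam₂))) y -
        (deriv (fun s => deriv (fun t => Real.tanh (a * s + lam₁) * (t + lam₂)) y) x) ^ 2
          = -a ^ 2 *
            (1 - (deriv (fun t => Real.tanh (a * x + lam₁) * (t + lam₂)) y) ^ 2) ^ 2) := by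
  intro x y
  have hyy : deriv (deriv fun t => Real.tanh (a * x + lam₁) * (t + lam₂)) y = 0 := by
    rw [funext (deriv_const_mul_add_const _ _)]
    exact deriv_const y _
  have hxy : deriv (fun s => Real.tanh (a * s + lam₁)) x
      = (1 / Real.cosh (a * x + lam₁)) ^ 2 * a := by
    have hlin : HasDerivAt (fun s => a * s + lam₁) a x := by
      simpa using ((hasDerivAt_id x).const_mul a).add_const lam₁
    exact ((Real.hasDerivAt_tanh_eq_one_div_cosh_sq _).comp x hlin).deriv
  refine ⟨?_, ?_, ?_⟩
  · rw [deriv_const_mul_add_const, Real.one_sub_tanh_sq_eq_one_div_cosh_sq]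
  · exact pow_ne_zero 2 (one_div_ne_zero (Real.cosh_pos _).ne')
  · simp only [hyy, deriv_const_mul_add_const, hxy, Real.one_sub_tanh_sq_eq_one_div_cosh_sq]
    ring
end

section
/- Let K₀ be a nonzero real constant, I, J ⊆ ℝ open intervals, and f : I → ℝ, g : J → ℝ smooth nonconstant functions such that 1 − (f(x)g'(y))² ≠ 0 and f(x)g(y)f''(x)g''(y) − (f'(x)g'(y))² = K₀·(1 − (f(x)g'(y))²)² for all (x,y) ∈ I×J. Then K₀ < 0. -/
/-- A real function whose derivative has no zero on an interval is injective there. -/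
lemma injOn_of_deriv_ne_zero {h : ℝ → ℝ} {J : Set ℝ} (hJ : J.OrdConnected)
    (hh : ∀ y ∈ J, deriv h y ≠ 0) : Set.InjOn h J := by
  have key : ∀ a ∈ J, ∀ b ∈ J, a < b → h a ≠ h b := by
    intro a ha b hb hab heq
    have hsub : Set.Icc a b ⊆ J := hJ.out ha hb
    obtain ⟨c, hc, hc0⟩ := exists_deriv_eq_zero hab
      (fun t ht => (differentiableAt_of_deriv_ne_zero
        (hh t (hsub ht))).continuousAt.continuousWithinAt) heq
    exact hh c (hsub (Set.Ioo_subset_Icc_self hc)) hc0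
  intro a ha b hb heq
  rcases lt_trichotomy a b with hab | hab | hab
  · exact absurd heq (key a ha b hb hab)
  · exact hab
  · exact absurd heq.symm (key b hb a ha hab)

/-- The outer coefficients of an even quartic vanishing on an infinite set are zero. -/
lemma quartic_coeffs_eq_zero_of_infinite (c₀ c₂ c₄ : ℝ) {S : Set ℝ} (hS : S.Infinite)
    (h : ∀ t ∈ S, c₀ + c₂ * t ^ 2 + c₄ * t ^ 4 = 0) : c₀ = 0 ∧ c₄ = 0 := by
  open Polynomial in
  have hp : (C c₀ + C c₂ * X ^ 2 + C c₄ * X ^ 4 : ℝ[X]) = 0 :=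
    eq_zero_of_infinite_isRoot _ (hS.mono fun t ht => by simpa [IsRoot] using h t ht)
  constructor
  · simpa using congrArg (fun p => Polynomial.coeff p 0) hp
  · simpa [Polynomial.coeff_X_pow, Polynomial.coeff_C] using
      congrArg (fun p => Polynomial.coeff p 4) hp

/-- A factorable surface of first kind `z(x,y) = f(x) g(y)` with nonconstant `f, g` and
nonzero constant Gaussian curvature `K₀` must have negative curvature: `K₀ < 0`. -/
theorem factorable_first_kind_constant_gauss_curvature_neg
    (K₀ : ℝ) (hK₀ : K₀ ≠ 0)
    (I J : Set ℝ) (hIo : IsOpen I) (hIc : I.OrdConnected) (hIn : I.Nonempty)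
    (hJo : IsOpen J) (hJc : J.OrdConnected) (hJn : J.Nonempty)
    (f g : ℝ → ℝ) (hf : ContDiffOn ℝ (⊤ : ℕ∞) f I) (hg : ContDiffOn ℝ (⊤ : ℕ∞) g J)
    (hfnc : ¬ ∃ c : ℝ, ∀ x ∈ I, f x = c)
    (hgnc : ¬ ∃ c : ℝ, ∀ y ∈ J, g y = c)
    (hnl : ∀ x ∈ I, ∀ y ∈ J, 1 - (f x * deriv g y) ^ 2 ≠ 0)
    (heq : ∀ x ∈ I, ∀ y ∈ J,
      f x * g y * deriv (deriv f) x * deriv (deriv g) y - (deriv f x * deriv g y) ^ 2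
        = K₀ * (1 - (f x * deriv g y) ^ 2) ^ 2) :
    K₀ < 0 := by
  by_contra hneg
  have hK : 0 < K₀ := lt_of_le_of_ne (not_lt.mp hneg) hK₀.symm
  have hpos : ∀ x ∈ I, ∀ y ∈ J, 0 < f x * g y * deriv (deriv f) x * deriv (deriv g) y := by
    intro x hx y hy
    have h1 : 0 < K₀ * (1 - (f x * deriv g y) ^ 2) ^ 2 :=
      mul_pos hK (by have := hnl x hx y hy; positivity)
    have h2 := heq x hx y hy
    nlinarith [sq_nonneg (deriv f x * deriv g y)]
  obtain ⟨x₀, hx₀⟩ := hIn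
  obtain ⟨y₀, hy₀⟩ := hJn
  have hf0 : ∀ x ∈ I, f x ≠ 0 := fun x hx h => by
    simpa [h] using hpos x hx y₀ hy₀
  have hf2 : ∀ x ∈ I, deriv (deriv f) x ≠ 0 := fun x hx h => by
    simpa [h] using hpos x hx y₀ hy₀
  have hg2 : ∀ y ∈ J, deriv (deriv g) y ≠ 0 := fun y hy h => by
    simpa [h] using hpos x₀ hx₀ y hy
  have hinf : (deriv g '' J).Infinite :=
    (infinite_of_mem_nhds y₀ (hJo.mem_nhds hy₀)).image (injOn_of_deriv_ne_zero hJc hg2)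
  have hpow : ∀ x ∈ I, f x ^ 4 = f x₀ ^ 4 := by
    intro x hx
    set A := f x * deriv (deriv f) x with hA
    set A₀ := f x₀ * deriv (deriv f) x₀ with hA₀
    have hA₀0 : A₀ ≠ 0 := mul_ne_zero (hf0 x₀ hx₀) (hf2 x₀ hx₀)
    have hquartic := quartic_coeffs_eq_zero_of_infinite (K₀ * (A₀ - A))
      (A₀ * (deriv f x ^ 2 - 2 * K₀ * f x ^ 2) - A * (deriv f x₀ ^ 2 - 2 * K₀ * f x₀ ^ 2))
      (K₀ * (A₀ * f x ^ 4 - A * f x₀ ^ 4)) hinf (by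
        rintro _ ⟨y, hy, rfl⟩
        linear_combination A * heq x₀ hx₀ y hy - A₀ * heq x hx y hy)
    have hAA : A₀ = A := sub_eq_zero.mp ((mul_eq_zero.mp hquartic.1).resolve_left hK₀)
    have h := sub_eq_zero.mp ((mul_eq_zero.mp hquartic.2).resolve_left hK₀)
    rw [← hAA] at h
    exact mul_left_cancel₀ hA₀0 h
  have hf1 : ∀ x ∈ I, deriv f x = 0 := by
    intro x hx
    have hd : HasDerivAt f (deriv f x) x :=
      ((hf.contDiffAt (hIo.mem_nhds hx)).differentiableAt (by simp)).hasDerivAt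
    have hc : HasDerivAt (fun t => f t ^ 4) 0 x :=
      (hasDerivAt_const x (f x₀ ^ 4)).congr_of_eventuallyEq
        (Filter.eventually_of_mem (hIo.mem_nhds hx) hpow)
    have h := (hd.pow 4).unique hc
    simpa [hf0 x hx] using h
  refine hf2 x₀ hx₀ ?_
  have h : deriv f =ᶠ[nhds x₀] fun _ => (0 : ℝ) :=
    Filter.eventually_of_mem (hIo.mem_nhds hx₀) hf1
  rw [h.deriv_eq, deriv_const]
end

section
/- Let H₀ be a nonzero real constant, I, J ⊆ ℝ open intervals, and f : I → ℝ, g : J → ℝ smooth functions such that 1 − (f(x)g'(y))² ≠ 0 and H₀ = f(x)g''(y)/(2·|1 − (f(x)g'(y))²|^{3/2}) for all (x,y) ∈ I×J. Then f' ≡ 0 on I, i.e. f is a constant function. -/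
open Polynomial in
/-- A function which takes only finitely many values near a point, being a root of a fixed
nonzero polynomial there, has vanishing derivative at that point. -/
theorem deriv_eq_zero_of_eventually_isRoot {f : ℝ → ℝ} {x : ℝ} {P : ℝ[X]} (hP : P ≠ 0)
    (h : ∀ᶠ z in nhds x, P.IsRoot (f z)) : deriv f x = 0 := by
  by_contra hd
  have hne : ∀ᶠ z in nhdsWithin x {x}ᶜ, ∀ c ∈ P.roots.toFinset, f z ≠ c :=
    (Filter.eventually_all_finset _).2 fun c _ =>
      (differentiableAt_of_deriv_ne_zero hd).hasDerivAt.eventually_ne hd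
  obtain ⟨z, hz, hroot⟩ := (hne.and (h.filter_mono nhdsWithin_le_nhds)).exists
  exact hz (f z) (by simpa [hP] using hroot) rfl

/-- The constant mean curvature equation with its fractional power cleared. -/
theorem pow_four_eq_of_eq_div_abs_rpow {H u p q : ℝ} (hw : 1 - (u * p) ^ 2 ≠ 0)
    (h : H = u * q / (2 * |1 - (u * p) ^ 2| ^ ((3 : ℝ) / 2))) :
    (u * q) ^ 4 = 16 * H ^ 4 * (1 - (u * p) ^ 2) ^ 6 := by
  have hpos : 0 < |1 - (u * p) ^ 2| := abs_pos.2 hw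
  have hpow : (|1 - (u * p) ^ 2| ^ ((3 : ℝ) / 2)) ^ 4 = (1 - (u * p) ^ 2) ^ 6 := by
    rw [← Real.rpow_mul_natCast hpos.le, ← (show Even 6 by decide).pow_abs, ← Real.rpow_natCast]
    norm_num
  have hrpow := Real.rpow_pos_of_pos hpos ((3 : ℝ) / 2)
  rw [eq_div_iff (by positivity)] at h
  rw [← h, ← hpow]
  ring

/-- For a factorable surface of first kind `z(x,y) = f(x) g(y)` with nonzero constant
mean curvature `H₀`, the factor `f` must be constant, i.e. `f' ≡ 0` on `I`. -/
theorem factorable_first_kind_constant_mean_curvature_f_constant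
    (H₀ : ℝ) (hH₀ : H₀ ≠ 0)
    (I J : Set ℝ) (hIo : IsOpen I) (hIc : I.OrdConnected) (hIn : I.Nonempty)
    (hJo : IsOpen J) (hJc : J.OrdConnected) (hJn : J.Nonempty)
    (f g : ℝ → ℝ) (hf : ContDiffOn ℝ (⊤ : ℕ∞) f I) (hg : ContDiffOn ℝ (⊤ : ℕ∞) g J)
    (hnl : ∀ x ∈ I, ∀ y ∈ J, 1 - (f x * deriv g y) ^ 2 ≠ 0)
    (heq : ∀ x ∈ I, ∀ y ∈ J,
      H₀ = f x * deriv (deriv g) y /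
        (2 * |1 - (f x * deriv g y) ^ 2| ^ ((3 : ℝ) / 2))) :
    ∀ x ∈ I, deriv f x = 0 := by
  intro x hx
  obtain ⟨y, hy⟩ := hJn
  let P : Polynomial ℝ := (.X * .C (deriv (deriv g) y)) ^ 4
    - .C (16 * H₀ ^ 4) * (1 - (.X * .C (deriv g y)) ^ 2) ^ 6
  have hP : P ≠ 0 := by
    intro h
    have h0 := congrArg (Polynomial.eval 0) h
    simp [P, hH₀] at h0
  refine deriv_eq_zero_of_eventually_isRoot hP ?_
  filter_upwards [hIo.mem_nhds hx] with z hz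
  have hz4 := pow_four_eq_of_eq_div_abs_rpow (hnl z hz y hy) (heq z hz y hy)
  simpa [P, Polynomial.IsRoot, sub_eq_zero, -Polynomial.X_mul_C] using hz4
end

section
/- Let H₀ ≠ 0 and f₀ ≠ 0 be real constants and J ⊆ ℝ an open interval. If g : J → ℝ is a twice differentiable function with |f₀·g'(y)| < 1 for all y ∈ J satisfying 2H₀ = f₀·g''(y)/(1 − (f₀·g'(y))²)^{3/2} on J, then there exist constants λ₁, λ₂ ∈ ℝ such that f₀·g(y) = (1/(2H₀))·√((2H₀·y + λ₁)² + 1) + λ₂ for all y ∈ J. -/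
/-- The antiderivative `u / √(1 - u²)` of `u' / (1 - u²)^{3/2}`. -/
lemma HasDerivAt.div_sqrt_one_sub_sq {u : ℝ → ℝ} {u' x : ℝ} (hu : HasDerivAt u u' x)
    (h : |u x| < 1) :
    HasDerivAt (fun y => u y / √(1 - u y ^ 2)) (u' / (1 - u x ^ 2) ^ ((3 : ℝ) / 2)) x := by
  have hpos : 0 < 1 - u x ^ 2 := sub_pos.2 ((sq_lt_one_iff_abs_lt_one _).2 h)
  have hs : 0 < √(1 - u x ^ 2) := Real.sqrt_pos.2 hpos
  have hsq : √(1 - u x ^ 2) ^ 2 = 1 - u x ^ 2 := Real.sq_sqrt hpos.le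
  have hpow : (1 - u x ^ 2) ^ ((3 : ℝ) / 2) = √(1 - u x ^ 2) ^ 3 := by
    rw [Real.sqrt_eq_rpow, ← Real.rpow_mul_natCast hpos.le]
    norm_num
  refine (hu.fun_div (((hu.fun_pow 2).const_sub 1).sqrt hpos.ne') hs.ne').congr_deriv ?_
  rw [hpow]
  field_simp
  norm_num
  exact .inl (by linear_combination 2 * hsq)

/-- The map `u ↦ u / √(1 - u²)` is inverted by `w ↦ w / √(w² + 1)`. -/
lemma eq_div_sqrt_sq_add_one_of_div_sqrt_one_sub_sq_eq {u w : ℝ} (hu : |u| < 1)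
    (h : u / √(1 - u ^ 2) = w) : u = w / √(w ^ 2 + 1) := by
  have hpos : 0 < 1 - u ^ 2 := sub_pos.2 ((sq_lt_one_iff_abs_lt_one _).2 hu)
  have hs : 0 < √(1 - u ^ 2) := Real.sqrt_pos.2 hpos
  have hw : w ^ 2 + 1 = (√(1 - u ^ 2))⁻¹ ^ 2 := by
    rw [← h, div_pow, inv_pow, Real.sq_sqrt hpos.le]
    field_simp
    ring
  rw [hw, Real.sqrt_sq (inv_nonneg.2 hs.le), ← h]
  field_simp

/-- A function with vanishing derivative on an open interval is constant there. -/
lemma exists_eq_const_of_hasDerivAt_zero {J : Set ℝ} (hJo : IsOpen J) (hJc : J.OrdConnected)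
    {f : ℝ → ℝ} (hf : ∀ y ∈ J, HasDerivAt f 0 y) : ∃ c, ∀ y ∈ J, f y = c :=
  hJo.exists_is_const_of_deriv_eq_zero hJc.isPreconnected
    (fun y hy => (hf y hy).differentiableAt.differentiableWithinAt)
    (fun y hy => (hf y hy).deriv)

/-- The ODE (3.7): a spacelike CMC factorable surface of first kind with constant `f₀`:
if `2H₀ = f₀ g''/(1 - (f₀ g')²)^{3/2}` with `|f₀ g'| < 1` on an open interval, then
`f₀ g(y) = (1/(2H₀)) √((2H₀ y + lam₁)² + 1) + lam₂`. -/
theorem ode_spacelike_cmc_first_kind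
    (H₀ f₀ : ℝ) (hH₀ : H₀ ≠ 0) (hf₀ : f₀ ≠ 0)
    (J : Set ℝ) (hJo : IsOpen J) (hJc : J.OrdConnected) (hJn : J.Nonempty)
    (g : ℝ → ℝ) (hg : ∀ y ∈ J, DifferentiableAt ℝ g y)
    (hg' : ∀ y ∈ J, DifferentiableAt ℝ (deriv g) y)
    (hbd : ∀ y ∈ J, |f₀ * deriv g y| < 1)
    (hode : ∀ y ∈ J,
      2 * H₀ = f₀ * deriv (deriv g) y / (1 - (f₀ * deriv g y) ^ 2) ^ ((3 : ℝ) / 2)) :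
    ∃ lam₁ lam₂ : ℝ, ∀ y ∈ J,
      f₀ * g y = (1 / (2 * H₀)) * Real.sqrt ((2 * H₀ * y + lam₁) ^ 2 + 1) + lam₂ := by
  obtain ⟨lam₁, h₁⟩ := exists_eq_const_of_hasDerivAt_zero hJo hJc
    (f := fun y => f₀ * deriv g y / √(1 - (f₀ * deriv g y) ^ 2) - 2 * H₀ * y) fun y hy => by
      have hd := ((hg' y hy).hasDerivAt.const_mul f₀).div_sqrt_one_sub_sq (hbd y hy)
      rw [← hode y hy] at hd
      simpa using hd.fun_sub ((hasDerivAt_id' y).const_mul (2 * H₀))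
  obtain ⟨lam₂, h₂⟩ := exists_eq_const_of_hasDerivAt_zero hJo hJc
    (f := fun y => f₀ * g y - 1 / (2 * H₀) * √((2 * H₀ * y + lam₁) ^ 2 + 1)) fun y hy => by
      have hu := eq_div_sqrt_sq_add_one_of_div_sqrt_one_sub_sq_eq (hbd y hy)
        (sub_eq_iff_eq_add'.1 (h₁ y hy))
      have hpos : 0 < (2 * H₀ * y + lam₁) ^ 2 + 1 := by positivity
      have hw := (((((hasDerivAt_id' y).const_mul (2 * H₀)).add_const lam₁).fun_pow 2).add_const
        1).sqrt hpos.ne'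
      refine (((hg y hy).hasDerivAt.const_mul f₀).fun_sub
        (hw.const_mul (1 / (2 * H₀)))).congr_deriv ?_
      rw [hu]
      have hs := (Real.sqrt_pos.2 hpos).ne'
      field_simp
      norm_num
  exact ⟨lam₁, lam₂, fun y hy => sub_eq_iff_eq_add'.1 (h₂ y hy)⟩
end

section
/- Let H₀ ≠ 0 and λ₁ be real constants and let z : ℝ → ℝ be defined by z(y) = (1/(2H₀))·√((2H₀·y + λ₁)² + 1) + λ₂. Then z is smooth, |z'(y)| < 1 for all y, and z''(y) = 2H₀·(1 − z'(y)²)^{3/2} for all y ∈ ℝ. In particular, the graph surface z(x,y) = z(y) is a spacelike factorable surface of first kind with constant mean curvature H₀ in the pseudo-Galilean space. -/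
theorem hasDerivAt_sqrt_affine_sq_add_one (a b y : ℝ) :
    HasDerivAt (fun y : ℝ => Real.sqrt ((a * y + b) ^ 2 + 1))
      (a * (a * y + b) / Real.sqrt ((a * y + b) ^ 2 + 1)) y := by
  have hu : HasDerivAt (fun y : ℝ => a * y + b) a y := by
    simpa using ((hasDerivAt_id y).const_mul a).add_const b
  have hpos : (a * y + b) ^ 2 + 1 ≠ 0 := by positivity
  refine (((hu.fun_pow 2).add_const 1).sqrt hpos).congr_deriv ?_
  push_cast
  field_simp

theorem hasDerivAt_affine_div_sqrt (a b y : ℝ) :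
    HasDerivAt (fun y : ℝ => (a * y + b) / Real.sqrt ((a * y + b) ^ 2 + 1))
      (a / Real.sqrt ((a * y + b) ^ 2 + 1) ^ 3) y := by
  have hu : HasDerivAt (fun y : ℝ => a * y + b) a y := by
    simpa using ((hasDerivAt_id y).const_mul a).add_const b
  have hs : 0 < Real.sqrt ((a * y + b) ^ 2 + 1) := by positivity
  have hsq : Real.sqrt ((a * y + b) ^ 2 + 1) ^ 2 = (a * y + b) ^ 2 + 1 :=
    Real.sq_sqrt (by positivity)
  refine (hu.fun_div (hasDerivAt_sqrt_affine_sq_add_one a b y) hs.ne').congr_deriv ?_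
  generalize Real.sqrt ((a * y + b) ^ 2 + 1) = s at hs hsq ⊢
  field_simp
  rw [hsq]
  ring

theorem one_sub_div_sqrt_sq (u : ℝ) :
    1 - (u / Real.sqrt (u ^ 2 + 1)) ^ 2 = (1 / Real.sqrt (u ^ 2 + 1)) ^ 2 := by
  have hpos : u ^ 2 + 1 ≠ 0 := by positivity
  rw [div_pow, div_pow, Real.sq_sqrt (by positivity)]
  field_simp
  ring

/-- The function `z(y) = (1/(2H₀)) √((2H₀ y + lam₁)² + 1) + lam₂` is smooth, satisfies
`|z'| < 1` and `z'' = 2H₀ (1 - z'²)^{3/2}`; i.e. the graph `z(x,y) = z(y)` is a spacelike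
factorable surface of first kind with constant mean curvature `H₀`. -/
theorem spacelike_cmc_example_first_kind
    (H₀ lam₁ lam₂ : ℝ) (hH₀ : H₀ ≠ 0) :
    ContDiff ℝ (⊤ : ℕ∞)
        (fun y : ℝ => (1 / (2 * H₀)) * Real.sqrt ((2 * H₀ * y + lam₁) ^ 2 + 1) + lam₂) ∧
      (∀ y : ℝ,
        |deriv (fun y : ℝ =>
          (1 / (2 * H₀)) * Real.sqrt ((2 * H₀ * y + lam₁) ^ 2 + 1) + lam₂) y| < 1) ∧
      (∀ y : ℝ,
        deriv (deriv (fun y : ℝ =>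
            (1 / (2 * H₀)) * Real.sqrt ((2 * H₀ * y + lam₁) ^ 2 + 1) + lam₂)) y
          = 2 * H₀ *
            (1 - (deriv (fun y : ℝ =>
              (1 / (2 * H₀)) * Real.sqrt ((2 * H₀ * y + lam₁) ^ 2 + 1) + lam₂) y) ^ 2)
              ^ ((3 : ℝ) / 2)) := by
  have hderiv : deriv (fun y : ℝ =>
      (1 / (2 * H₀)) * Real.sqrt ((2 * H₀ * y + lam₁) ^ 2 + 1) + lam₂) =
      fun y => (2 * H₀ * y + lam₁) / Real.sqrt ((2 * H₀ * y + lam₁) ^ 2 + 1) := by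
    funext y
    rw [(((hasDerivAt_sqrt_affine_sq_add_one (2 * H₀) lam₁ y).const_mul
      (1 / (2 * H₀))).add_const lam₂).deriv]
    field_simp
  rw [hderiv]
  refine ⟨?_, fun y => ?_, fun y => ?_⟩
  · have hinner : ContDiff ℝ (⊤ : ℕ∞) (fun y : ℝ => (2 * H₀ * y + lam₁) ^ 2 + 1) := by
      fun_prop
    exact (contDiff_const.mul (hinner.sqrt fun y => by positivity)).add contDiff_const
  · have hpos : 0 < (1 / Real.sqrt ((2 * H₀ * y + lam₁) ^ 2 + 1)) ^ 2 := by positivity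
    rw [← sq_lt_one_iff_abs_lt_one]
    linarith [one_sub_div_sqrt_sq (2 * H₀ * y + lam₁)]
  · have hnonneg : 0 ≤ 1 / Real.sqrt ((2 * H₀ * y + lam₁) ^ 2 + 1) := by positivity
    have hpow (t : ℝ) (ht : 0 ≤ t) : (t ^ 2) ^ ((3 : ℝ) / 2) = t ^ 3 := by
      rw [← Real.rpow_natCast t 2, ← Real.rpow_mul ht, ← Real.rpow_natCast t 3]
      norm_num
    rw [(hasDerivAt_affine_div_sqrt (2 * H₀) lam₁ y).deriv, one_sub_div_sqrt_sq,
      hpow _ hnonneg, one_div_pow, mul_one_div]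
end

section
/- Let H₀ ≠ 0 and λ₁ ≠ 0 be real constants and J ⊆ ℝ an open interval. Suppose g : J → ℝ is a smooth nonvanishing function whose logarithmic derivative w = g'/g satisfies w(z)² > λ₁² and 2H₀ = λ₁²·w'(z)/(w(z)² − λ₁²)^{3/2} for all z ∈ J. Then there exist constants λ₂ ∈ ℝ, λ₃ ≠ 0, and a sign ε ∈ {−1,1} such that g(z) = λ₃·exp(ε·(λ₁/(2H₀))·√((2H₀·z + λ₂)² − 1)) for all z ∈ J. -/
theorem IsOpen.exists_eqOn_const_of_hasDerivAt_zero {J : Set ℝ} (hJo : IsOpen J)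
    (hJc : J.OrdConnected) (hJn : J.Nonempty) {f : ℝ → ℝ} (hf : ∀ z ∈ J, HasDerivAt f 0 z) :
    ∃ c, ∀ z ∈ J, f z = c := by
  obtain ⟨z₀, hz₀⟩ := hJn
  exact ⟨f z₀, fun z hz => hJo.is_const_of_deriv_eq_zero hJc.isPreconnected
    (fun x hx => (hf x hx).differentiableAt.differentiableWithinAt)
    (fun x hx => (hf x hx).deriv) hz hz₀⟩

theorem hasDerivAt_div_sqrt_sq_sub_sq {w : ℝ → ℝ} {w' a z : ℝ} (hw : HasDerivAt w w' z)
    (h : a ^ 2 < w z ^ 2) :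
    HasDerivAt (fun t => w t / √(w t ^ 2 - a ^ 2))
      (-(a ^ 2 * w' / (w z ^ 2 - a ^ 2) ^ ((3 : ℝ) / 2))) z := by
  have hpos : 0 < w z ^ 2 - a ^ 2 := sub_pos.2 h
  have hrpow : (w z ^ 2 - a ^ 2) ^ ((3 : ℝ) / 2) = √(w z ^ 2 - a ^ 2) ^ 3 := by
    rw [Real.sqrt_eq_rpow, ← Real.rpow_mul_natCast hpos.le]
    norm_num
  have hS : 0 < √(w z ^ 2 - a ^ 2) := Real.sqrt_pos.2 hpos
  have hS2 : √(w z ^ 2 - a ^ 2) ^ 2 = w z ^ 2 - a ^ 2 := Real.sq_sqrt hpos.le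
  have hd := hw.div (((hw.pow 2).sub_const (a ^ 2)).sqrt hpos.ne') hS.ne'
  refine hd.congr_deriv ?_
  rw [hrpow]
  simp only [Pi.pow_apply]
  generalize √(w z ^ 2 - a ^ 2) = S at hS hS2
  field_simp
  push_cast
  linear_combination 2 * w' * hS2

theorem eq_neg_abs_mul_div_sqrt {w a u : ℝ} (ha : a ≠ 0) (h : a ^ 2 < w ^ 2)
    (hu : w / √(w ^ 2 - a ^ 2) = -u) : 1 < u ^ 2 ∧ w = -(|a| * u / √(u ^ 2 - 1)) := by
  have hpos : 0 < w ^ 2 - a ^ 2 := sub_pos.2 h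
  have hS : 0 < √(w ^ 2 - a ^ 2) := Real.sqrt_pos.2 hpos
  have hS2 : √(w ^ 2 - a ^ 2) ^ 2 = w ^ 2 - a ^ 2 := Real.sq_sqrt hpos.le
  generalize √(w ^ 2 - a ^ 2) = S at hS hS2 hu
  have hw : w = -u * S := (div_eq_iff hS.ne').1 hu
  have ha' : 0 < |a| := abs_pos.2 ha
  have key : u ^ 2 - 1 = (|a| / S) ^ 2 := by
    rw [div_pow, sq_abs, eq_div_iff (by positivity)]
    rw [hw] at hS2
    linear_combination -hS2
  refine ⟨sub_pos.1 (key ▸ by positivity), ?_⟩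
  rw [key, Real.sqrt_sq (by positivity), hw]
  field_simp

theorem exists_eq_mul_exp_of_hasDerivAt {J : Set ℝ} (hJo : IsOpen J) (hJc : J.OrdConnected)
    (hJn : J.Nonempty) {g φ : ℝ → ℝ} {w : ℝ → ℝ} (hgne : ∀ z ∈ J, g z ≠ 0)
    (hg : ∀ z ∈ J, HasDerivAt g (w z * g z) z) (hφ : ∀ z ∈ J, HasDerivAt φ (w z) z) :
    ∃ c, c ≠ 0 ∧ ∀ z ∈ J, g z = c * Real.exp (φ z) := by
  obtain ⟨c, hc⟩ := hJo.exists_eqOn_const_of_hasDerivAt_zero hJc hJn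
    (f := fun z => g z * Real.exp (-φ z)) fun z hz =>
      ((hg z hz).mul (hφ z hz).neg.exp).congr_deriv (by ring)
  refine ⟨c, ?_, fun z hz => ?_⟩
  · obtain ⟨z₀, hz₀⟩ := hJn
    rw [← hc z₀ hz₀]
    exact mul_ne_zero (hgne z₀ hz₀) (Real.exp_ne_zero _)
  · rw [← hc z hz, mul_assoc, ← Real.exp_add, neg_add_cancel, Real.exp_zero, mul_one]


/-- The ODE (4.28): if the logarithmic derivative `w = g'/g` of a smooth nonvanishing
function `g` satisfies `w² > lam₁²` and `2H₀ = lam₁² w'/(w² - lam₁²)^{3/2}` on an open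
interval, then `g(z) = lam₃ exp(ε (lam₁/(2H₀)) √((2H₀ z + lam₂)² - 1))`. -/
theorem ode_second_kind_cmc
    (H₀ lam₁ : ℝ) (hH₀ : H₀ ≠ 0) (hlam₁ : lam₁ ≠ 0)
    (J : Set ℝ) (hJo : IsOpen J) (hJc : J.OrdConnected) (hJn : J.Nonempty)
    (g : ℝ → ℝ) (hg : ContDiffOn ℝ (⊤ : ℕ∞) g J) (hgne : ∀ z ∈ J, g z ≠ 0)
    (hbd : ∀ z ∈ J, (deriv g z / g z) ^ 2 > lam₁ ^ 2)
    (hode : ∀ z ∈ J,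
      2 * H₀ = lam₁ ^ 2 * deriv (fun t => deriv g t / g t) z /
        ((deriv g z / g z) ^ 2 - lam₁ ^ 2) ^ ((3 : ℝ) / 2)) :
    ∃ (lam₂ lam₃ ε : ℝ), lam₃ ≠ 0 ∧ (ε = 1 ∨ ε = -1) ∧
      ∀ z ∈ J, g z = lam₃ *
        Real.exp (ε * (lam₁ / (2 * H₀)) * Real.sqrt ((2 * H₀ * z + lam₂) ^ 2 - 1)) := by
  have hgd : ∀ z ∈ J, DifferentiableAt ℝ g z := fun z hz =>
    (hg.contDiffAt (hJo.mem_nhds hz)).differentiableAt (by simp)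
  have hg'd : ∀ z ∈ J, DifferentiableAt ℝ (deriv g) z := fun z hz =>
    ((hg.deriv_of_isOpen (m := 1) hJo (by norm_cast)).contDiffAt
      (hJo.mem_nhds hz)).differentiableAt (by simp)
  obtain ⟨c, hc⟩ := hJo.exists_eqOn_const_of_hasDerivAt_zero hJc hJn
    (f := fun z => deriv g z / g z / √((deriv g z / g z) ^ 2 - lam₁ ^ 2) + 2 * H₀ * z)
    fun z hz => by
      have hw : HasDerivAt (fun t => deriv g t / g t) _ z :=
        ((hg'd z hz).div (hgd z hz) (hgne z hz)).hasDerivAt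
      refine ((hasDerivAt_div_sqrt_sq_sub_sq hw (hbd z hz)).add
        ((hasDerivAt_id z).const_mul (2 * H₀))).congr_deriv ?_
      linear_combination hode z hz
  have hu : ∀ z ∈ J, 1 < (2 * H₀ * z + -c) ^ 2 ∧
      deriv g z / g z = -(|lam₁| * (2 * H₀ * z + -c) / √((2 * H₀ * z + -c) ^ 2 - 1)) :=
    fun z hz => eq_neg_abs_mul_div_sqrt hlam₁ (hbd z hz) (by linear_combination hc z hz)
  obtain ⟨ε, hε, hεabs⟩ : ∃ ε : ℝ, (ε = 1 ∨ ε = -1) ∧ ε * lam₁ = -|lam₁| := by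
    rcases abs_choice lam₁ with h | h
    · exact ⟨-1, .inr rfl, by rw [h]; ring⟩
    · exact ⟨1, .inl rfl, by rw [h]; ring⟩
  obtain ⟨lam₃, hlam₃, hsol⟩ := exists_eq_mul_exp_of_hasDerivAt hJo hJc hJn hgne
    (w := fun z => deriv g z / g z)
    (φ := fun z => ε * (lam₁ / (2 * H₀)) * √((2 * H₀ * z + -c) ^ 2 - 1))
    (fun z hz => by
      simpa only [div_mul_cancel₀ _ (hgne z hz)] using (hgd z hz).hasDerivAt)
    (fun z hz => by
      obtain ⟨h1, h2⟩ := hu z hz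
      have hpos : 0 < (2 * H₀ * z + -c) ^ 2 - 1 := sub_pos.2 h1
      have hlin : HasDerivAt (fun t => 2 * H₀ * t + -c) (2 * H₀) z := by
        simpa using ((hasDerivAt_id z).const_mul (2 * H₀)).add_const (-c)
      refine ((((hlin.pow 2).sub_const 1).sqrt hpos.ne').const_mul _).congr_deriv ?_
      have hS : √((2 * H₀ * z + -c) ^ 2 - 1) ≠ 0 := (Real.sqrt_pos.2 hpos).ne'
      rw [h2]
      simp only [Pi.pow_apply]
      generalize √((2 * H₀ * z + -c) ^ 2 - 1) = S at hS
      field_simp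
      push_cast
      linear_combination 2 * (2 * H₀ * z - c) * hεabs)
  exact ⟨-c, lam₃, ε, hlam₃, hε, hsol⟩
end
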